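/- Let n₁, n₂ ∈ ℕ and let 𝒜₁ = [[A, B], [Bᵗ, D]] be a symmetric positive definite real matrix of size (n₂+n₁) × (n₂+n₁), with blocks A of size n₂×n₂, B of size n₂×n₁, D of size n₁×n₁. Then the subspace L₁ = {((x₂, i(Ax₂ + Bx₁)), (x₁, i(−Bᵗx₂ − Dx₁))) : x₂ ∈ ℂ^{n₂}, x₁ ∈ ℂ^{n₁}} of (ℂ^{n₂} × ℂ^{n₂}) ⊕ (ℂ^{n₁} × ℂ^{n₁}) (i.e. the graph of i𝒜̃₁ where 𝒜̃₁ = [[A, B], [−Bᵗ, −D]]) is a positive Lagrangian subspace with respect to the form Ω₂ ⊖ Ω₁, where Ωⱼ is the complex hyperbolic form on ℂ^{nⱼ} × ℂ^{nⱼ}, and componentwise complex conjugation. -/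

import Mathlib

open scoped BigOperators
open Matrix

/-- The complex hyperbolic form on `ℂⁿ × ℂⁿ`. -/
noncomputable def hypForm (n : ℕ) (v w : (Fin n → ℂ) × (Fin n → ℂ)) : ℂ :=
  (∑ i, v.1 i * w.2 i) - (∑ i, w.1 i * v.2 i)

/-- Componentwise complex conjugation on `ℂⁿ × ℂⁿ`. -/
noncomputable def conjPair (n : ℕ) (v : (Fin n → ℂ) × (Fin n → ℂ)) :
    (Fin n → ℂ) × (Fin n → ℂ) :=
  (fun i => (starRingEnd ℂ) (v.1 i), fun i => (starRingEnd ℂ) (v.2 i))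

/-- The difference form `Ω_W ⊖ Ω_U` on `W ⊕ U`. -/
noncomputable def diffForm {W U : Type*} (ΩW : W → W → ℂ) (ΩU : U → U → ℂ)
    (x y : W × U) : ℂ :=
  ΩW x.1 y.1 - ΩU x.2 y.2

/-- `L` is a positive Lagrangian subspace with respect to the bilinear form `Ω` and the
conjugation `conj`. -/
def IsPosLagrangian {V : Type*} [AddCommGroup V] [Module ℂ V]
    (Ω : V → V → ℂ) (conj : V → V) (L : Submodule ℂ V) : Prop :=
  (∀ v ∈ L, ∀ w ∈ L, Ω v w = 0) ∧
  (∀ v : V, (∀ w ∈ L, Ω v w = 0) → v ∈ L) ∧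
  (∀ v ∈ L, v ≠ 0 →
    0 < (-Complex.I * Ω (conj v) v).re ∧ (-Complex.I * Ω (conj v) v).im = 0)

/-- Action of a real matrix on complex vectors via its complexification. -/
noncomputable def cmulVec {m k : ℕ} (R : Matrix (Fin m) (Fin k) ℝ) (x : Fin k → ℂ) :
    Fin m → ℂ :=
  (R.map Complex.ofReal).mulVec x

/-- The Hermitian form of a real positive definite matrix is real and positive on nonzero
complex vectors. -/
theorem Matrix.PosDef.complex_dotProduct_mulVec_pos {ι : Type*} [Fintype ι] {M : Matrix ι ι ℝ}
    (hM : M.PosDef) {x : ι → ℂ} (hx : x ≠ 0) :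
    0 < (star x ⬝ᵥ (M.map Complex.ofReal *ᵥ x)).re ∧
      (star x ⬝ᵥ (M.map Complex.ofReal *ᵥ x)).im = 0 := by
  have hsymm : Mᵀ = M := by simpa [conjTranspose_eq_transpose_of_trivial] using hM.isHermitian.eq
  set u : ι → ℝ := fun i => (x i).re
  set v : ι → ℝ := fun i => (x i).im
  have hcast (a b : ι → ℝ) :
      (Complex.ofReal ∘ a) ⬝ᵥ (M.map Complex.ofReal *ᵥ (Complex.ofReal ∘ b)) =
        ((a ⬝ᵥ (M *ᵥ b) : ℝ) : ℂ) := by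
    simp [dotProduct, mulVec]
  have hx_eq : x = Complex.ofReal ∘ u + Complex.I • (Complex.ofReal ∘ v) := by
    ext i
    simp [u, v, mul_comm Complex.I, Complex.re_add_im]
  have hstar : star x = Complex.ofReal ∘ u - Complex.I • (Complex.ofReal ∘ v) := by
    ext i
    apply Complex.ext <;> simp [u, v]
  have hcomm : u ⬝ᵥ (M *ᵥ v) = v ⬝ᵥ (M *ᵥ u) := by
    rw [← dotProduct_transpose_mulVec, hsymm]
  have hval : star x ⬝ᵥ (M.map Complex.ofReal *ᵥ x) =
      ((u ⬝ᵥ (M *ᵥ u) + v ⬝ᵥ (M *ᵥ v) : ℝ) : ℂ) := by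
    rw [hstar, hx_eq]
    simp only [mulVec_add, mulVec_smul, dotProduct_add, sub_dotProduct, smul_dotProduct,
      dotProduct_smul, hcast, hcomm, smul_eq_mul, Complex.ofReal_add]
    linear_combination (-((v ⬝ᵥ (M *ᵥ v) : ℝ) : ℂ)) * Complex.I_mul_I
  have hnonneg (a : ι → ℝ) : 0 ≤ a ⬝ᵥ (M *ᵥ a) := by
    simpa using hM.posSemidef.dotProduct_mulVec_nonneg a
  have hpos {a : ι → ℝ} (ha : a ≠ 0) : 0 < a ⬝ᵥ (M *ᵥ a) := by
    simpa using hM.dotProduct_mulVec_pos ha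
  rw [hval, Complex.ofReal_re, Complex.ofReal_im]
  refine ⟨?_, rfl⟩
  by_cases hu : u = 0
  · refine add_pos_of_nonneg_of_pos (hnonneg u) (hpos fun hv => hx ?_)
    ext i
    exact Complex.ext (congrFun hu i) (congrFun hv i)
  · exact add_pos_of_pos_of_nonneg (hpos hu) (hnonneg v)

theorem hypForm_eq_dotProduct (n : ℕ) (v w : (Fin n → ℂ) × (Fin n → ℂ)) :
    hypForm n v w = v.1 ⬝ᵥ w.2 - w.1 ⬝ᵥ v.2 :=
  rfl

theorem conjPair_eq_star (n : ℕ) (v : (Fin n → ℂ) × (Fin n → ℂ)) :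
    conjPair n v = (star v.1, star v.2) :=
  rfl

theorem star_cmulVec {m k : ℕ} (R : Matrix (Fin m) (Fin k) ℝ) (x : Fin k → ℂ) :
    star (cmulVec R x) = cmulVec R (star x) := by
  ext i
  simp [cmulVec, mulVec, dotProduct]

theorem dotProduct_cmulVec_comm {m k : ℕ} (R : Matrix (Fin m) (Fin k) ℝ)
    (x : Fin m → ℂ) (y : Fin k → ℂ) :
    x ⬝ᵥ cmulVec R y = y ⬝ᵥ cmulVec Rᵀ x := by
  rw [cmulVec, cmulVec, transpose_map, dotProduct_transpose_mulVec]

theorem cmulVec_zero {m k : ℕ} (R : Matrix (Fin m) (Fin k) ℝ) : cmulVec R 0 = 0 :=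
  mulVec_zero _

/-- Let `𝒜₁ = [[A, B], [Bᵗ, D]]` be a symmetric positive definite real matrix.  Then the
graph of `i𝒜̃₁` (where `𝒜̃₁ = [[A, B], [−Bᵗ, −D]]`), i.e. the subspace
`L₁ = {((x₂, i(Ax₂ + Bx₁)), (x₁, i(−Bᵗx₂ − Dx₁)))}` of
`(ℂ^{n₂} × ℂ^{n₂}) ⊕ (ℂ^{n₁} × ℂ^{n₁})`, is a positive Lagrangian subspace with respect
to `Ω₂ ⊖ Ω₁` and componentwise conjugation. -/
theorem posLagrangian_tilde_graph (n₁ n₂ : ℕ)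
    (A : Matrix (Fin n₂) (Fin n₂) ℝ) (B : Matrix (Fin n₂) (Fin n₁) ℝ)
    (D : Matrix (Fin n₁) (Fin n₁) ℝ)
    (hpos : (Matrix.fromBlocks A B Bᵀ D).PosDef)
    (L₁ : Submodule ℂ (((Fin n₂ → ℂ) × (Fin n₂ → ℂ)) × ((Fin n₁ → ℂ) × (Fin n₁ → ℂ))))
    (hL₁ : (L₁ : Set (((Fin n₂ → ℂ) × (Fin n₂ → ℂ)) × ((Fin n₁ → ℂ) × (Fin n₁ → ℂ)))) =
      {z | ∃ (x₂ : Fin n₂ → ℂ) (x₁ : Fin n₁ → ℂ),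
        z = ((x₂, Complex.I • (cmulVec A x₂ + cmulVec B x₁)),
             (x₁, Complex.I • (-cmulVec Bᵀ x₂ - cmulVec D x₁)))}) :
    IsPosLagrangian (diffForm (hypForm n₂) (hypForm n₁))
      (Prod.map (conjPair n₂) (conjPair n₁)) L₁ := by
  obtain ⟨hA, -, -, hD⟩ := isHermitian_fromBlocks_iff.mp hpos.isHermitian
  replace hA : Aᵀ = A := by simpa [conjTranspose_eq_transpose_of_trivial] using hA.eq
  replace hD : Dᵀ = D := by simpa [conjTranspose_eq_transpose_of_trivial] using hD.eq
  have hmem z : z ∈ L₁ ↔ ∃ (x₂ : Fin n₂ → ℂ) (x₁ : Fin n₁ → ℂ),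
      z = ((x₂, Complex.I • (cmulVec A x₂ + cmulVec B x₁)),
           (x₁, Complex.I • (-cmulVec Bᵀ x₂ - cmulVec D x₁))) := by
    rw [← SetLike.mem_coe, hL₁, Set.mem_ofPred_eq]
  have hAc (x y : Fin n₂ → ℂ) : x ⬝ᵥ cmulVec A y = y ⬝ᵥ cmulVec A x := by
    rw [dotProduct_cmulVec_comm, hA]
  have hDc (x y : Fin n₁ → ℂ) : x ⬝ᵥ cmulVec D y = y ⬝ᵥ cmulVec D x := by
    rw [dotProduct_cmulVec_comm, hD]
  refine ⟨fun v hv w hw => ?_, fun v hv => ?_, fun v hv hv0 => ?_⟩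
  · obtain ⟨x₂, x₁, rfl⟩ := (hmem v).mp hv
    obtain ⟨y₂, y₁, rfl⟩ := (hmem w).mp hw
    simp only [diffForm, hypForm_eq_dotProduct, dotProduct_smul, dotProduct_add, dotProduct_sub,
      dotProduct_neg, smul_eq_mul]
    rw [hAc x₂, hDc x₁, dotProduct_cmulVec_comm B x₂, dotProduct_cmulVec_comm B y₂]
    ring
  · obtain ⟨⟨a, p⟩, ⟨b, q⟩⟩ := v
    have key (x₂ : Fin n₂ → ℂ) (x₁ : Fin n₁ → ℂ) := hv _ ((hmem _).mpr ⟨x₂, x₁, rfl⟩)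
    simp only [diffForm, hypForm_eq_dotProduct, dotProduct_smul, dotProduct_add, dotProduct_sub,
      dotProduct_neg, smul_eq_mul] at key
    have hp : p = Complex.I • (cmulVec A a + cmulVec B b) := by
      refine dotProduct_eq _ _ fun x => ?_
      have h := key x 0
      simp only [cmulVec_zero, dotProduct_zero, zero_dotProduct] at h
      rw [hAc a, ← dotProduct_cmulVec_comm B x] at h
      rw [dotProduct_comm p, dotProduct_comm _ x]
      simp only [dotProduct_smul, dotProduct_add, smul_eq_mul]
      linear_combination -h
    have hq : q = Complex.I • (-cmulVec Bᵀ a - cmulVec D b) := by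
      refine dotProduct_eq _ _ fun x => ?_
      have h := key 0 x
      simp only [cmulVec_zero, dotProduct_zero, zero_dotProduct] at h
      rw [hDc b, dotProduct_cmulVec_comm B a] at h
      rw [dotProduct_comm q, dotProduct_comm _ x]
      simp only [dotProduct_smul, dotProduct_sub, dotProduct_neg, smul_eq_mul]
      linear_combination h
    exact (hmem _).mpr ⟨a, b, by rw [hp, hq]⟩
  · obtain ⟨x₂, x₁, rfl⟩ := (hmem v).mp hv
    have hx : Sum.elim x₂ x₁ ≠ 0 := by
      intro h
      have h₂ : x₂ = 0 := funext fun i => congrFun h (Sum.inl i)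
      have h₁ : x₁ = 0 := funext fun i => congrFun h (Sum.inr i)
      exact hv0 (by simp [h₁, h₂, cmulVec_zero])
    have hlt := hpos.complex_dotProduct_mulVec_pos hx
    have hstar : star (Sum.elim x₂ x₁) = Sum.elim (star x₂) (star x₁) := by
      ext (i | i) <;> rfl
    rw [fromBlocks_map, fromBlocks_mulVec, hstar, sumElim_dotProduct_sumElim] at hlt
    simp only [Sum.elim_comp_inl, Sum.elim_comp_inr, ← cmulVec.eq_1] at hlt
    set Q := star x₂ ⬝ᵥ (cmulVec A x₂ + cmulVec B x₁) +
      star x₁ ⬝ᵥ (cmulVec Bᵀ x₂ + cmulVec D x₁) with hQ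
    have hform : -Complex.I * diffForm (hypForm n₂) (hypForm n₁)
        (Prod.map (conjPair n₂) (conjPair n₁)
          ((x₂, Complex.I • (cmulVec A x₂ + cmulVec B x₁)),
           (x₁, Complex.I • (-cmulVec Bᵀ x₂ - cmulVec D x₁))))
        ((x₂, Complex.I • (cmulVec A x₂ + cmulVec B x₁)),
         (x₁, Complex.I • (-cmulVec Bᵀ x₂ - cmulVec D x₁))) = 2 * Q := by
      simp only [diffForm, hypForm_eq_dotProduct, Prod.map_apply, conjPair_eq_star, star_smul,
        star_add, star_sub, star_neg, star_cmulVec, dotProduct_smul, dotProduct_add,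
        dotProduct_sub, dotProduct_neg, smul_eq_mul, hQ, RCLike.star_def, Complex.conj_I]
      rw [hAc x₂, hDc x₁, dotProduct_cmulVec_comm B x₂, dotProduct_cmulVec_comm B (star x₂)]
      ring_nf
      simp only [Complex.I_sq]
      ring
    rw [hform]
    obtain ⟨hre, him⟩ := hlt
    simp [hre, him]
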